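/- The first three moments of $Y_n = (X_n - n/2)/\sqrt{n}$ converge: $\mathbb{E}(Y_n) \to \sqrt{2/\pi}$, $\mathbb{E}(Y_n^2) \to 3/4$, and $\mathbb{E}(Y_n^3) \to \sqrt{2/\pi}$ as $n \to \infty$, where $\mathbb{E}(Y_n^r) = 2^{-n} \sum_{w \in \{a,b\}^n} \big((g(w) - n/2)/\sqrt{n}\big)^r$. -/

import Mathlib

/-- Two-color majority-guessing correct count (`true = a`, `false = b`). -/
def chat : List Bool → ℕ
  | [] => 0
  | x :: w =>
      chat w + if decide ((x :: w).count true ≥ (x :: w).count false) = x then 1 else 0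

/-- Riffle-shuffle correct-guess count. -/
def g : List Bool → ℕ
  | [] => 0
  | true :: w => 1 + g w
  | false :: w => if w = List.replicate w.length false then w.length + 1 else chat w

/-- `E(Y_n^r) = 2^{-n} ∑_{w ∈ {a,b}^n} ((g(w) - n/2)/√n)^r`. -/
noncomputable def momY (n r : ℕ) : ℝ :=
  (∑ w : Fin n → Bool, (((g (List.ofFn w) : ℝ) - (n : ℝ) / 2) / Real.sqrt n) ^ r) / 2 ^ n

open Filter Topology

/-- Expectation over uniform words of length `n`. -/
noncomputable def EE (n : ℕ) (F : List Bool → ℝ) : ℝ :=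
  (∑ w : Fin n → Bool, F (List.ofFn w)) / 2 ^ n

lemma EE_zero (F : List Bool → ℝ) : EE 0 F = F [] := by
  simp [EE]

lemma EE_succ (n : ℕ) (F : List Bool → ℝ) :
    EE (n + 1) F = EE n (fun w => (F (true :: w) + F (false :: w)) / 2) := by
  unfold EE
  rw [← (Fin.consEquiv (fun _ : Fin (n + 1) => Bool)).sum_comp, Fintype.sum_prod_type]
  have hc : ∀ (b : Bool) (w : Fin n → Bool),
      List.ofFn ((Fin.consEquiv (fun _ : Fin (n + 1) => Bool)) (b, w)) = b :: List.ofFn w := by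
    intro b w
    exact List.ofFn_cons b w
  simp only [Fintype.sum_bool, hc]
  rw [← Finset.sum_add_distrib, ← Finset.sum_div, div_div, pow_succ, mul_comm (2 : ℝ)]

lemma EE_congr (n : ℕ) {F F' : List Bool → ℝ} (h : ∀ w, w.length = n → F w = F' w) :
    EE n F = EE n F' := by
  unfold EE
  congr 1
  exact Finset.sum_congr rfl fun w _ => h _ (by simp)

lemma EE_add (n : ℕ) (F F' : List Bool → ℝ) :
    EE n (fun w => F w + F' w) = EE n F + EE n F' := by
  simp only [EE, Finset.sum_add_distrib, add_div]

lemma EE_sub (n : ℕ) (F F' : List Bool → ℝ) :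
    EE n (fun w => F w - F' w) = EE n F - EE n F' := by
  simp only [EE, Finset.sum_sub_distrib, sub_div]

lemma EE_mul (n : ℕ) (c : ℝ) (F : List Bool → ℝ) :
    EE n (fun w => c * F w) = c * EE n F := by
  simp only [EE, ← Finset.mul_sum, mul_div_assoc]

lemma EE_const (n : ℕ) (c : ℝ) : EE n (fun _ => c) = c := by
  simp [EE]

/-- Twice the correct count minus the length. -/
def Zz (w : List Bool) : ℤ := 2 * (chat w : ℤ) - w.length

def dd (w : List Bool) : ℤ := (w.count true : ℤ) - w.count false

def hh (w : List Bool) : ℤ := if 0 ≤ dd w then dd w else - dd w - 1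

lemma dd_true (w : List Bool) : dd (true :: w) = dd w + 1 := by
  simp [dd]; ring

lemma dd_false (w : List Bool) : dd (false :: w) = dd w - 1 := by
  simp [dd]; ring

lemma Zz_true (w : List Bool) : Zz (true :: w) = Zz w + if -1 ≤ dd w then 1 else -1 := by
  simp only [Zz, dd, chat, List.length_cons]
  by_cases h : List.count true w + 1 ≥ List.count false w
  · have h2 : (-1 : ℤ) ≤ (w.count true : ℤ) - w.count false := by omega
    simp [h, h2]; ring
  · have h2 : ¬ (-1 : ℤ) ≤ (w.count true : ℤ) - w.count false := by omega
    simp only [h2, if_false]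
    simp [h]; ring

lemma Zz_false (w : List Bool) : Zz (false :: w) = Zz w + if dd w ≤ 0 then 1 else -1 := by
  simp only [Zz, dd, chat, List.length_cons]
  by_cases h : List.count true w ≥ List.count false w + 1
  · have h2 : ¬ (w.count true : ℤ) - w.count false ≤ 0 := by omega
    simp only [h2, if_false]
    simp [h]; ring
  · have h2 : (w.count true : ℤ) - w.count false ≤ 0 := by omega
    simp only [h2, if_true]
    simp [h]; ring

def PP (φ : ℤ → ℤ → ℝ) (z h : ℤ) : ℝ :=
  if h = 0 then φ (z + 1) 0 + φ (z + 1) 1 else φ (z + 1) (h + 1) + φ (z - 1) (h - 1)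

lemma step_eq (φ : ℤ → ℤ → ℝ) (w : List Bool) :
    φ (Zz (true :: w)) (hh (true :: w)) + φ (Zz (false :: w)) (hh (false :: w))
      = PP φ (Zz w) (hh w) := by
  rw [Zz_true, Zz_false]
  unfold hh PP
  rw [dd_true, dd_false]
  generalize dd w = d
  generalize Zz w = z
  rcases lt_trichotomy d (-1) with h | h | h
  · have h1 : ¬ (-1 ≤ d) := by omega
    have h2 : d ≤ 0 := by omega
    have h3 : ¬ (0 ≤ d + 1) := by omega
    have h4 : ¬ (0 ≤ d - 1) := by omega
    have h5 : ¬ (0 ≤ d) := by omega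
    have h6 : ¬ (-d - 1 = 0) := by omega
    simp only [h1, h2, h3, h4, h5, h6, if_true, if_false]
    rw [add_comm]
    congr 2 <;> ring
  · subst h
    norm_num
  · rcases eq_or_lt_of_le (show 0 ≤ d by omega) with h0 | h0
    · subst h0
      norm_num
      ring
    · have h1 : (-1 ≤ d) := by omega
      have h2 : ¬ d ≤ 0 := by omega
      have h3 : (0 ≤ d + 1) := by omega
      have h4 : (0 ≤ d - 1) := by omega
      have h5 : (0 ≤ d) := by omega
      have h6 : ¬ (d = 0) := by omega
      simp only [h1, h2, h3, h4, h5, h6, if_true, if_false]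
      congr 2

lemma uniform (n : ℕ) : ∀ φ : ℤ → ℤ → ℝ,
    (∀ z : ℕ, ∑ h ∈ Finset.range (z + 1), φ z h = 0) →
    EE n (fun w => φ (Zz w) (hh w)) = 0 := by
  induction n with
  | zero =>
    intro φ hφ
    have := hφ 0
    rw [EE_zero]
    simpa [Zz, hh, dd, chat] using this
  | succ n ih =>
    intro φ hφ
    rw [EE_succ]
    simp only [step_eq]
    have := ih (fun z h => (1 / 2) * PP φ z h) (by
      intro z
      rw [← Finset.mul_sum]
      have e1 := hφ (z + 1)
      rw [Finset.sum_range_succ', Finset.sum_range_succ'] at e1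
      rw [Finset.sum_range_succ']
      have e2 : ∑ k ∈ Finset.range z, φ ((z : ℤ) - 1) (k : ℤ) = 0 := by
        cases z with
        | zero => simp
        | succ z => simpa using hφ z
      have e3 : ∀ k ∈ Finset.range z, PP φ z ((k + 1 : ℕ) : ℤ)
          = φ ((z + 1 : ℕ) : ℤ) ((k + 1 + 1 : ℕ) : ℤ) + φ ((z : ℤ) - 1) (k : ℤ) := by
        intro k _
        unfold PP
        rw [if_neg (by omega)]
        push_cast
        congr 2
        ring
      rw [Finset.sum_congr rfl e3, Finset.sum_add_distrib, e2]
      simp only [PP]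
      push_cast at e1 ⊢
      norm_num at e1 ⊢
      linarith)
    rw [← this]
    apply EE_congr
    intro w _
    ring

noncomputable def RR (w : List Bool) : ℝ := (Zz w : ℝ) + 1

/-- Indicator of being at zero. -/
def II (w : List Bool) : ℝ := if hh w = 0 then 1 else 0

lemma uniform' (n : ℕ) (ψ : ℤ → ℝ) :
    EE n (fun w => II w * RR w * ψ (Zz w)) = EE n (fun w => ψ (Zz w)) := by
  have := uniform n (fun z h => (if h = 0 then 1 else 0) * ((z : ℝ) + 1) * ψ z - ψ z) (by
    intro z
    rw [Finset.sum_sub_distrib, Finset.sum_range_succ']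
    simp
    have : ∀ k : ℕ, ((k : ℤ) + 1 = 0) ↔ False := by intro k; simp; omega
    simp [this])
  rw [EE_sub] at this
  unfold II RR
  linarith

lemma step_pow (r : ℕ) (w : List Bool) :
    RR (true :: w) ^ r + RR (false :: w) ^ r =
      II w * (2 * (RR w + 1) ^ r) + (1 - II w) * ((RR w + 1) ^ r + (RR w - 1) ^ r) := by
  have := step_eq (fun z _ => ((z : ℝ) + 1) ^ r) w
  unfold RR II
  rw [this]
  unfold PP
  push_cast
  split_ifs
  · ring
  · ring

lemma mu1 (n : ℕ) : EE (n + 1) RR = EE n RR + EE n II := by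
  rw [EE_succ, ← EE_add]
  apply EE_congr
  intro w _
  have := step_pow 1 w
  simp only [pow_one] at this
  rw [this]; ring

lemma mu2 (n : ℕ) : EE n (fun w => RR w ^ 2) = 1 + 3 * n := by
  induction n with
  | zero => simp [EE_zero, RR, Zz, chat]
  | succ n ih =>
    rw [EE_succ]
    have h := uniform' n (fun _ => 1)
    rw [EE_const] at h
    have : EE n (fun w => (RR (true :: w) ^ 2 + RR (false :: w) ^ 2) / 2)
      = EE n (fun w => (RR w ^ 2 + 1) + 2 * (II w * RR w * 1)) := by
      apply EE_congr
      intro w _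
      rw [step_pow]; ring
    rw [this, EE_add, EE_mul, h, EE_add, EE_const, ih]
    push_cast; ring

lemma mu3 (n : ℕ) : EE (n + 1) (fun w => RR w ^ 3)
    = EE n (fun w => RR w ^ 3) + 6 * EE n RR + EE n II := by
  rw [EE_succ]
  have h := uniform' n (fun z => z + 1)
  change EE n (fun w => II w * RR w * RR w) = EE n RR at h
  have : EE n (fun w => (RR (true :: w) ^ 3 + RR (false :: w) ^ 3) / 2)
      = EE n (fun w => ((RR w ^ 3 + 3 * RR w) + 3 * (II w * RR w * RR w)) + II w) := by
    apply EE_congr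
    intro w _
    rw [step_pow]; ring
  rw [this, EE_add, EE_add, EE_add, EE_mul, EE_mul, h]
  ring

lemma count_choose (n : ℕ) : ∀ k : ℕ,
    EE n (fun w => if w.count true = k then 1 else 0) = (n.choose k : ℝ) / 2 ^ n := by
  induction n with
  | zero =>
    intro k
    rw [EE_zero]
    cases k <;> simp
  | succ n ih =>
    intro k
    rw [EE_succ]
    cases k with
    | zero =>
      have h := ih 0
      have : EE n (fun w => ((if (true :: w).count true = 0 then 1 else 0) +
          (if (false :: w).count true = 0 then 1 else 0)) / 2)
        = EE n (fun w => (1 / 2) * (if w.count true = 0 then 1 else 0)) := by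
        apply EE_congr
        intro w _
        split_ifs <;> simp_all
      rw [this, EE_mul, h]
      simp [pow_succ]
    | succ k =>
      have : EE n (fun w => ((if (true :: w).count true = k + 1 then 1 else 0) +
          (if (false :: w).count true = k + 1 then 1 else 0)) / 2)
        = EE n (fun w => (1 / 2) * (if w.count true = k then 1 else 0)
          + (1 / 2) * (if w.count true = k + 1 then 1 else 0)) := by
        apply EE_congr
        intro w _
        simp; split_ifs <;> norm_num
      rw [this, EE_add, EE_mul, EE_mul, ih, ih, Nat.choose_succ_succ, pow_succ]
      push_cast
      ring

lemma EE_II (n : ℕ) : EE n II = (n.choose (n / 2) : ℝ) / 2 ^ n := by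
  rw [← count_choose]
  apply EE_congr
  intro w hw
  unfold II
  have h1 : w.count true + w.count false = n := by
    rw [← hw]; exact List.count_true_add_count_false w
  have : hh w = 0 ↔ w.count true = n / 2 := by
    unfold hh dd
    split_ifs <;> omega
  simp [this]

noncomputable def qq (m : ℕ) : ℝ := (m.centralBinom : ℝ) / 4 ^ m

lemma qq_succ (m : ℕ) : qq (m + 1) = qq m * (2 * m + 1) / (2 * m + 2) := by
  have h := Nat.succ_mul_centralBinom_succ m
  have h' : ((m : ℝ) + 1) * (m + 1).centralBinom = 2 * (2 * m + 1) * m.centralBinom := by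
    exact_mod_cast h
  unfold qq
  rw [pow_succ]
  field_simp
  linarith

lemma EE_II_even (m : ℕ) : EE (2 * m) II = qq m := by
  rw [EE_II, qq, Nat.centralBinom, pow_mul]
  norm_num

lemma EE_II_odd (m : ℕ) : EE (2 * m + 1) II = qq m * (2 * m + 1) / (2 * m + 2) := by
  rw [EE_II, show (2 * m + 1) / 2 = m by omega, qq, Nat.centralBinom, pow_succ, pow_mul]
  have h := Nat.add_one_mul_choose_eq (2 * m) m
  have h2 : (2 * m + 1).choose (m + 1) = (2 * m + 1).choose m := by
    rw [Nat.choose_symm_half]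
  rw [h2] at h
  have h' : (2 * (m : ℝ) + 1) * (2 * m).choose m = (2 * m + 1).choose m * (m + 1) := by
    exact_mod_cast h
  norm_num
  field_simp
  linarith

lemma closed (m : ℕ) : EE (2 * m) RR = (4 * m + 1) * qq m ∧
    EE (2 * m) (fun w => RR w ^ 3) = (32 * m ^ 2 + 8 * m + 1) * qq m := by
  induction m with
  | zero => simp [EE_zero, RR, Zz, chat, qq]
  | succ m ih =>
    obtain ⟨h1, h3⟩ := ih
    rw [show 2 * (m + 1) = 2 * m + 1 + 1 by ring, mu1, mu3, mu1, mu3, EE_II_even, EE_II_odd,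
      h1, h3, qq_succ]
    push_cast
    constructor <;> (field_simp; ring)

lemma closed_odd (m : ℕ) : EE (2 * m + 1) RR = (4 * m + 2) * qq m ∧
    EE (2 * m + 1) (fun w => RR w ^ 3) = 8 * (2 * m + 1) ^ 2 * qq m := by
  obtain ⟨h1, h3⟩ := closed m
  rw [mu1, mu3, EE_II_even, h1, h3]
  constructor <;> ring

noncomputable def ep (n : ℕ) : ℝ := if n % 2 = 0 then 1 else 0

lemma closed_n (n : ℕ) : EE n RR = (2 * n + ep n) * qq (n / 2) ∧
    EE n (fun w => RR w ^ 3) = (8 * n ^ 2 + ep n * (4 * n + 1)) * qq (n / 2) := by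
  rcases Nat.even_or_odd' n with ⟨m, rfl | rfl⟩
  · obtain ⟨h1, h3⟩ := closed m
    rw [h1, h3]
    simp [ep]
    constructor <;> (left; ring)
  · obtain ⟨h1, h3⟩ := closed_odd m
    rw [h1, h3, show (2 * m + 1) / 2 = m by omega]
    simp [ep]
    left; ring

lemma qq_W (m : ℕ) : qq m ^ 2 * (2 * m + 1) * Real.Wallis.W m = 1 := by
  induction m with
  | zero => simp [qq, Real.Wallis.W]
  | succ m ih =>
    rw [qq_succ, Real.Wallis.W_succ]
    refine Eq.trans ?_ ih
    push_cast
    field_simp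
    ring

lemma ep_div : Tendsto (fun n : ℕ => ep n / (n : ℝ)) atTop (𝓝 0) := by
  refine squeeze_zero (fun n => ?_) (fun n => ?_) (tendsto_const_div_atTop_nhds_zero_nat (1 : ℝ))
  · unfold ep; split_ifs <;> positivity
  · unfold ep; split_ifs
    · exact le_rfl
    · rw [zero_div]; positivity

lemma kappa : Tendsto (fun n : ℕ => qq (n / 2) * Real.sqrt n) atTop
    (𝓝 (Real.sqrt (2 / Real.pi))) := by
  have hW : Tendsto (fun n : ℕ => Real.Wallis.W (n / 2)) atTop (𝓝 (Real.pi / 2)) :=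
    Real.Wallis.tendsto_W_nhds_pi_div_two.comp (Nat.tendsto_div_const_atTop (by norm_num))
  have h1 : Tendsto (fun n : ℕ => (1 + ep n / (n : ℝ))⁻¹ * (Real.Wallis.W (n / 2))⁻¹) atTop
      (𝓝 ((1 + 0)⁻¹ * (Real.pi / 2)⁻¹)) :=
    ((ep_div.const_add 1).inv₀ (by norm_num)).mul (hW.inv₀ (by positivity))
  rw [add_zero, inv_one, one_mul, inv_div] at h1
  refine (h1.sqrt).congr' ?_
  filter_upwards [eventually_ge_atTop 1] with n hn
  have hn' : (0 : ℝ) < n := by exact_mod_cast hn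
  have hq : 0 ≤ qq (n / 2) := by unfold qq; positivity
  rw [← Real.sqrt_sq hq, ← Real.sqrt_mul (by positivity)]
  congr 1
  have h2 : ((2 * (n / 2 : ℕ) : ℝ) + 1) = n + ep n := by
    unfold ep
    split_ifs with h
    · have : 2 * (n / 2) + 1 = n + 1 := by omega
      exact_mod_cast this
    · have : 2 * (n / 2) + 1 = n := by omega
      rw [add_zero]
      exact_mod_cast this
  have h3 := qq_W (n / 2)
  rw [h2] at h3
  have hWp := Real.Wallis.W_pos (n / 2)
  have hep : 0 ≤ ep n := by unfold ep; split_ifs <;> norm_num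
  have : qq (n / 2) ^ 2 = ((n + ep n) * Real.Wallis.W (n / 2))⁻¹ := by
    apply eq_inv_of_mul_eq_one_left
    linarith
  rw [this]
  have : 0 < n + ep n := by positivity
  have : 1 + ep n / n = (n + ep n) / n := by field_simp
  rw [this]
  field_simp

lemma lim1 : Tendsto (fun n : ℕ => EE n RR / Real.sqrt n) atTop
    (𝓝 (2 * Real.sqrt (2 / Real.pi))) := by
  have h := (ep_div.const_add 2).mul kappa
  rw [add_zero] at h
  refine h.congr' ?_
  filter_upwards [eventually_ge_atTop 1] with n hn
  have hn' : (0 : ℝ) < n := by exact_mod_cast hn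
  have hs : 0 < Real.sqrt n := Real.sqrt_pos.2 hn'
  have hs2 : Real.sqrt n ^ 2 = n := Real.sq_sqrt hn'.le
  rw [(closed_n n).1]
  field_simp
  rw [hs2]
  ring

lemma lim3 : Tendsto (fun n : ℕ => EE n (fun w => RR w ^ 3) / Real.sqrt n ^ 3) atTop
    (𝓝 (8 * Real.sqrt (2 / Real.pi))) := by
  have h0 := tendsto_const_div_atTop_nhds_zero_nat (1 : ℝ)
  have h := ((ep_div.mul (h0.const_add 4)).const_add 8).mul kappa
  rw [zero_mul, add_zero] at h
  refine h.congr' ?_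
  filter_upwards [eventually_ge_atTop 1] with n hn
  have hn' : (0 : ℝ) < n := by exact_mod_cast hn
  have hs : 0 < Real.sqrt n := Real.sqrt_pos.2 hn'
  have hs2 : Real.sqrt n ^ 2 = n := Real.sq_sqrt hn'.le
  have hs4 : Real.sqrt n ^ 4 = n ^ 2 := by
    rw [show Real.sqrt n ^ 4 = (Real.sqrt n ^ 2) ^ 2 by ring, hs2]
  rw [(closed_n n).2]
  field_simp
  rw [hs4]
  field_simp

noncomputable def GG (w : List Bool) : ℝ := 2 * (g w : ℝ) - w.length

/-- Indicator of the all-`b` word. -/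
def bI (w : List Bool) : ℝ := if w = List.replicate w.length false then 1 else 0

lemma chat_replicate (n : ℕ) : chat (List.replicate n false) = n := by
  induction n with
  | zero => simp [chat]
  | succ n ih =>
    rw [List.replicate_succ, chat, ih]
    simp [List.count_replicate]

lemma GG_true (w : List Bool) : GG (true :: w) = GG w + 1 := by
  simp [GG, g]; ring

lemma GG_false (w : List Bool) : GG (false :: w) = RR w - 2 + 2 * bI w := by
  unfold GG g bI RR Zz
  split_ifs with h
  · have h2 : chat w = w.length := by
      conv_lhs => rw [h]
      rw [chat_replicate]
    rw [h2]
    push_cast [List.length_cons]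
    ring
  · push_cast [List.length_cons]
    ring

lemma bI_sq (w : List Bool) : bI w ^ 2 = bI w := by
  unfold bI; split_ifs <;> norm_num

lemma bI_RR (w : List Bool) : bI w * RR w = bI w * (w.length + 1) := by
  unfold bI RR Zz
  split_ifs with h
  · have h2 : chat w = w.length := by
      conv_lhs => rw [h]
      rw [chat_replicate]
    rw [h2]
    push_cast
    ring
  · simp

lemma EE_bI (n : ℕ) : EE n bI = (1 / 2) ^ n := by
  induction n with
  | zero => simp [EE_zero, bI]
  | succ n ih =>
    rw [EE_succ]
    have : EE n (fun w => (bI (true :: w) + bI (false :: w)) / 2)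
        = EE n (fun w => (1 / 2) * bI w) := by
      apply EE_congr
      intro w _
      simp [bI, List.replicate_succ]
      split_ifs <;> norm_num
    rw [this, EE_mul, ih]
    ring

lemma G1 (n : ℕ) : EE (n + 1) GG = (1 / 2) * EE n GG + ((1 / 2) * EE n RR + (-(1 / 2) + (1 / 2) ^ n)) := by
  rw [EE_succ]
  have : EE n (fun w => (GG (true :: w) + GG (false :: w)) / 2)
      = EE n (fun w => (1 / 2) * GG w + ((1 / 2) * RR w + (-(1 / 2) + bI w))) := by
    apply EE_congr
    intro w _
    rw [GG_true, GG_false]; ring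
  rw [this, EE_add, EE_add, EE_add, EE_mul, EE_mul, EE_const, EE_bI]

lemma G2 (n : ℕ) : EE (n + 1) (fun w => GG w ^ 2) = (1 / 2) * EE n (fun w => GG w ^ 2)
    + (EE n GG + ((1 / 2) * EE n (fun w => RR w ^ 2) + ((-2) * EE n RR +
      (5 / 2 + (2 * n) * (1 / 2) ^ n)))) := by
  rw [EE_succ]
  have : EE n (fun w => (GG (true :: w) ^ 2 + GG (false :: w) ^ 2) / 2)
      = EE n (fun w => (1 / 2) * GG w ^ 2 + (GG w + ((1 / 2) * RR w ^ 2 + ((-2) * RR w +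
        (5 / 2 + (2 * n) * bI w))))) := by
    apply EE_congr
    intro w hw
    rw [GG_true, GG_false]
    have h1 := bI_sq w
    have h2 := bI_RR w
    rw [hw] at h2
    linear_combination 2 * h1 + 2 * h2
  simp only [this, EE_add, EE_mul, EE_const, EE_bI]

lemma G3 (n : ℕ) : EE (n + 1) (fun w => GG w ^ 3) = (1 / 2) * EE n (fun w => GG w ^ 3)
    + ((3 / 2) * EE n (fun w => GG w ^ 2) + ((3 / 2) * EE n GG +
      ((1 / 2) * EE n (fun w => RR w ^ 3) + ((-3) * EE n (fun w => RR w ^ 2) + (6 * EE n RR +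
      (-(7 / 2) + (3 * n ^ 2 + 1) * (1 / 2) ^ n)))))) := by
  rw [EE_succ]
  have : EE n (fun w => (GG (true :: w) ^ 3 + GG (false :: w) ^ 3) / 2)
      = EE n (fun w => (1 / 2) * GG w ^ 3 + ((3 / 2) * GG w ^ 2 + ((3 / 2) * GG w +
      ((1 / 2) * RR w ^ 3 + ((-3) * RR w ^ 2 + (6 * RR w +
      (-(7 / 2) + (3 * n ^ 2 + 1) * bI w))))))) := by
    apply EE_congr
    intro w hw
    rw [GG_true, GG_false]
    have h1 := bI_sq w
    have h2 := bI_RR w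
    rw [hw] at h2
    linear_combination (4 * bI w + 6 * RR w - 8) * h1 + (3 * RR w + 3 * n - 3) * h2
  simp only [this, EE_add, EE_mul, EE_const, EE_bI]

/-- Contracting recursions converge. -/
lemma contract_zero (e d : ℕ → ℝ) (he : ∀ n, 0 ≤ e n) (hd : Tendsto d atTop (𝓝 0))
    (h : ∀ n, e (n + 1) ≤ (1 / 2) * e n + d n) : Tendsto e atTop (𝓝 0) := by
  rw [Metric.tendsto_atTop]
  intro ε hε
  obtain ⟨N, hN⟩ := (Metric.tendsto_atTop.1 hd) (ε / 4) (by positivity)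
  have key : ∀ k, e (N + k) ≤ (1 / 2) ^ k * e N + ε / 2 := by
    intro k
    induction k with
    | zero => simp; positivity
    | succ k ih =>
      have h1 := h (N + k)
      have h2 := hN (N + k) (by omega)
      rw [Real.dist_eq, sub_zero] at h2
      have h3 := (abs_lt.1 h2).2
      rw [← add_assoc, pow_succ]
      linarith
  have hp : Tendsto (fun k : ℕ => (1 / 2 : ℝ) ^ k * e N) atTop (𝓝 (0 * e N)) :=
    (tendsto_pow_atTop_nhds_zero_of_lt_one (by norm_num) (by norm_num)).mul_const _
  rw [zero_mul] at hp
  obtain ⟨K, hK⟩ := (Metric.tendsto_atTop.1 hp) (ε / 2) (by positivity)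
  refine ⟨N + K, fun n hn => ?_⟩
  obtain ⟨k, rfl⟩ := Nat.exists_eq_add_of_le (show N ≤ n by omega)
  have h1 := hK k (by omega)
  rw [Real.dist_eq, sub_zero] at h1 ⊢
  have h2 := (abs_lt.1 h1).2
  rw [abs_of_nonneg (he _)]
  linarith [key k]

lemma sqrt_ratio (r : ℕ) :
    Tendsto (fun n : ℕ => (Real.sqrt n / Real.sqrt (n + 1 : ℕ)) ^ r) atTop (𝓝 1) := by
  have h0 : Tendsto (fun n : ℕ => (n : ℝ) / (n + 1 : ℕ)) atTop (𝓝 1) := by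
    simpa using tendsto_natCast_div_add_atTop (1 : ℝ)
  have h1 := (h0.sqrt).pow r
  rw [Real.sqrt_one, one_pow] at h1
  refine h1.congr fun n => ?_
  rw [Real.sqrt_div (by positivity)]

lemma contract (r : ℕ) (a b : ℕ → ℝ) (c : ℝ)
    (h : ∀ n, a (n + 1) = (1 / 2) * a n + b n)
    (hb : Tendsto (fun n : ℕ => b n / Real.sqrt n ^ r) atTop (𝓝 (c / 2))) :
    Tendsto (fun n : ℕ => a n / Real.sqrt n ^ r) atTop (𝓝 c) := by
  have hρ := sqrt_ratio r
  set ρ : ℕ → ℝ := fun n => (Real.sqrt n / Real.sqrt (n + 1 : ℕ)) ^ r with hρdef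
  have hρ0 : ∀ n, 0 ≤ ρ n := fun n => by positivity
  have hρ1 : ∀ n, ρ n ≤ 1 := fun n => by
    apply pow_le_one₀ (by positivity)
    apply div_le_one_of_le₀ _ (by positivity)
    apply Real.sqrt_le_sqrt
    push_cast; linarith
  set u : ℕ → ℝ := fun n => a (n + 1) / Real.sqrt (n + 1 : ℕ) ^ r with hu
  have hrec : ∀ n, u (n + 1) - c = (1 / 2) * ρ (n + 1) * (u n - c) +
      ((1 / 2) * ρ (n + 1) * c - c + ρ (n + 1) * (b (n + 1) / Real.sqrt (n + 1 : ℕ) ^ r)) := by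
    intro n
    have p1 : 0 < Real.sqrt (n + 1 : ℕ) := Real.sqrt_pos.2 (by positivity)
    have p2 : 0 < Real.sqrt (n + 1 + 1 : ℕ) := Real.sqrt_pos.2 (by positivity)
    simp only [hu, hρdef, h (n + 1), div_pow]
    field_simp
    ring
  have hb' := (tendsto_add_atTop_iff_nat 1).2 hb
  have hρ' := (tendsto_add_atTop_iff_nat 1).2 hρ
  have hd : Tendsto (fun n => |(1 / 2) * ρ (n + 1) * c - c +
      ρ (n + 1) * (b (n + 1) / Real.sqrt (n + 1 : ℕ) ^ r)|) atTop (𝓝 0) := by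
    have := ((((hρ'.const_mul (1 / 2)).mul_const c).sub_const c).add (hρ'.mul hb')).abs
    convert this using 2
    ring_nf
    simp
  have he := contract_zero (fun n => |u n - c|) _ (fun n => abs_nonneg _) hd (by
    intro n
    rw [hrec n]
    refine (abs_add_le _ _).trans ?_
    gcongr
    rw [abs_mul, abs_of_nonneg (by have := hρ0 (n + 1); positivity)]
    have := mul_le_mul_of_nonneg_right (hρ1 (n + 1)) (abs_nonneg (u n - c))
    linarith)
  rw [← tendsto_add_atTop_iff_nat 1, ← tendsto_sub_nhds_zero_iff]
  exact (tendsto_zero_iff_abs_tendsto_zero _).2 he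

lemma sqrt_inv : Tendsto (fun n : ℕ => 1 / Real.sqrt n) atTop (𝓝 0) := by
  simp only [one_div]
  exact tendsto_inv_atTop_zero.comp (Real.tendsto_sqrt_atTop.comp tendsto_natCast_atTop_atTop)

/-- Lowering the order. -/
lemma lower (r : ℕ) (a : ℕ → ℝ) (c : ℝ)
    (h : Tendsto (fun n : ℕ => a n / Real.sqrt n ^ r) atTop (𝓝 c)) :
    Tendsto (fun n : ℕ => a n / Real.sqrt n ^ (r + 1)) atTop (𝓝 0) := by
  have := h.mul sqrt_inv
  rw [mul_zero] at this
  refine this.congr fun n => ?_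
  rw [pow_succ, div_mul_div_comm, mul_one]

lemma lower0 (r : ℕ) (a : ℕ → ℝ) (c : ℝ) (h : Tendsto a atTop (𝓝 c)) :
    Tendsto (fun n : ℕ => a n / Real.sqrt n ^ (r + 1)) atTop (𝓝 0) := by
  induction r with
  | zero => exact lower 0 a c (by simpa using h)
  | succ r ih => exact lower (r + 1) a 0 ih

lemma tiny (k : ℕ) : Tendsto (fun n : ℕ => (n : ℝ) ^ k * (1 / 2) ^ n) atTop (𝓝 0) :=
  tendsto_pow_const_mul_const_pow_of_abs_lt_one k (by rw [abs_lt]; norm_num)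

lemma limG1 : Tendsto (fun n : ℕ => EE n GG / Real.sqrt n ^ 1) atTop
    (𝓝 (2 * Real.sqrt (2 / Real.pi))) := by
  refine contract 1 _ _ _ G1 ?_
  have t := lower0 0 (fun n : ℕ => -(1 / 2) + (1 / 2 : ℝ) ^ n) (-(1 / 2) + 0)
    ((by simpa using tiny 0 : Tendsto (fun n : ℕ => (1 / 2 : ℝ) ^ n) atTop (𝓝 0)).const_add _)
  have := (lim1.const_mul (1 / 2)).add t
  convert this using 2
  · rw [zero_add, pow_one]; ring
  · ring

lemma lim2 : Tendsto (fun n : ℕ => EE n (fun w => RR w ^ 2) / Real.sqrt n ^ 2) atTop (𝓝 3) := by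
  have h0 := (tendsto_const_div_atTop_nhds_zero_nat (1 : ℝ)).add_const 3
  rw [zero_add] at h0
  refine h0.congr' ?_
  filter_upwards [eventually_ge_atTop 1] with n hn
  have hn' : (0 : ℝ) < n := by exact_mod_cast hn
  rw [mu2, Real.sq_sqrt hn'.le]
  field_simp

lemma limG2 : Tendsto (fun n : ℕ => EE n (fun w => GG w ^ 2) / Real.sqrt n ^ 2) atTop (𝓝 3) := by
  refine contract 2 _ _ _ G2 ?_
  have t := lower0 1 (fun n : ℕ => 5 / 2 + (2 * n) * (1 / 2 : ℝ) ^ n) (5 / 2 + 2 * 0)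
    (by
      refine (((tiny 1).const_mul 2).const_add (5 / 2)).congr fun n => ?_
      ring)
  have l1 := lower 1 _ _ limG1
  have l2 := lower 1 (fun n => EE n RR) _ (by simpa using lim1)
  have := l1.add ((lim2.const_mul (1 / 2)).add ((l2.const_mul (-2)).add t))
  convert this using 2
  · ring
  · ring

lemma limG3 : Tendsto (fun n : ℕ => EE n (fun w => GG w ^ 3) / Real.sqrt n ^ 3) atTop
    (𝓝 (8 * Real.sqrt (2 / Real.pi))) := by
  refine contract 3 _ _ _ G3 ?_
  have t := lower0 2 (fun n : ℕ => -(7 / 2) + (3 * n ^ 2 + 1) * (1 / 2 : ℝ) ^ n)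
    (-(7 / 2) + (3 * 0 + 0))
    (by
      refine ((((tiny 2).const_mul 3).add (tiny 0)).const_add (-(7 / 2))).congr fun n => ?_
      ring)
  have l1 := lower 2 _ _ (lower 1 _ _ limG1)
  have l2 := lower 2 _ _ (lower 1 (fun n => EE n RR) _ (by simpa using lim1))
  have l3 := lower 2 _ _ limG2
  have l4 := lower 2 _ _ lim2
  have := (l3.const_mul (3 / 2)).add ((l1.const_mul (3 / 2)).add ((lim3.const_mul (1 / 2)).add
    ((l4.const_mul (-3)).add ((l2.const_mul 6).add t))))
  convert this using 2
  · ring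
  · ring

lemma momY_eq (n r : ℕ) :
    momY n r = EE n (fun w => GG w ^ r) / Real.sqrt n ^ r / 2 ^ r := by
  have h : EE n (fun w => (((g w : ℝ) - (n : ℝ) / 2) / Real.sqrt n) ^ r) = momY n r := rfl
  rw [← h]
  have : EE n (fun w => (((g w : ℝ) - (n : ℝ) / 2) / Real.sqrt n) ^ r)
      = EE n (fun w => (1 / Real.sqrt n ^ r / 2 ^ r) * GG w ^ r) := by
    apply EE_congr
    intro w hw
    have : (g w : ℝ) - (n : ℝ) / 2 = GG w / 2 := by
      rw [GG, hw]; ring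
    rw [this, div_pow, div_pow]
    ring
  rw [this, EE_mul]
  ring

/-- The first three moments of `Y_n = (X_n - n/2)/√n` converge:
`E(Y_n) → √(2/π)`, `E(Y_n²) → 3/4`, `E(Y_n³) → √(2/π)`. -/
theorem stmt8 :
    Filter.Tendsto (fun n : ℕ => momY n 1) Filter.atTop (nhds (Real.sqrt (2 / Real.pi))) ∧
    Filter.Tendsto (fun n : ℕ => momY n 2) Filter.atTop (nhds (3 / 4)) ∧
    Filter.Tendsto (fun n : ℕ => momY n 3) Filter.atTop (nhds (Real.sqrt (2 / Real.pi))) := by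
  simp only [momY_eq]
  refine ⟨?_, ?_, ?_⟩
  · have := limG1.div_const (2 ^ 1)
    convert this using 2
    · simp
    · ring
  · have := limG2.div_const (2 ^ 2)
    convert this using 2
    norm_num
  · have := limG3.div_const (2 ^ 3)
    convert this using 2
    ring
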